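/- Let G be a finite group with |CD(G)| = |L(G)| - 1. Then the unique subgroup of G not belonging to CD(G) is the trivial subgroup, i.e., CD(G) = L(G) \ {1}. -/

import Mathlib

/-- The Chermak-Delgado measure of a subgroup `H` of `G`: `m_G(H) = |H| * |C_G(H)|`. -/
noncomputable def cdMeasure (G : Type*) [Group G] (H : Subgroup G) : ℕ :=
  Nat.card H * Nat.card (Subgroup.centralizer (H : Set G))

/-- The Chermak-Delgado lattice of `G`: the set of subgroups whose Chermak-Delgado
measure is maximal among all subgroups of `G`. -/
def cdLattice (G : Type*) [Group G] : Set (Subgroup G) :=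
  {H | ∀ K : Subgroup G, cdMeasure G K ≤ cdMeasure G H}

/-- If all but one element of a finite nonempty type lie in `s`, then `s` omits a single point. -/
theorem exists_eq_univ_sdiff_singleton {α : Type*} [Finite α] [Nonempty α] {s : Set α}
    (h : Nat.card s = Nat.card α - 1) : ∃ a, s = Set.univ \ {a} := by
  have hpos : 0 < Nat.card α := Nat.card_pos
  have hsum := Set.ncard_add_ncard_compl s
  rw [← Nat.card_coe_set_eq s] at hsum
  obtain ⟨a, ha⟩ := Set.ncard_eq_one.mp (show sᶜ.ncard = 1 by omega)
  exact ⟨a, by rw [← ha, ← Set.compl_eq_univ_sdiff, compl_compl]⟩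

/-- For every prime `p` dividing the order of `G`, some subgroup of order `p` is centralized
by a Sylow `p`-subgroup, so that its centralizer has index prime to `p`. -/
theorem exists_card_eq_prime_not_dvd_index_centralizer {G : Type*} [Group G] [Finite G]
    {p : ℕ} (hp : p.Prime) (hdvd : p ∣ Nat.card G) :
    ∃ K : Subgroup G, Nat.card K = p ∧ ¬ p ∣ (Subgroup.centralizer (K : Set G)).index := by
  have : Fact p.Prime := ⟨hp⟩
  let P : Sylow p G := default
  have : Nontrivial P := by
    rw [← Finite.one_lt_card_iff_nontrivial]
    exact hp.one_lt.trans_le (Nat.le_of_dvd Nat.card_pos (P.dvd_card_of_dvd_card hdvd))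
  have := P.isPGroup'.center_nontrivial
  have hcenter : p ∣ Nat.card (Subgroup.center P) := by
    obtain ⟨n, hn, hcard⟩ :=
      (P.isPGroup'.to_subgroup (Subgroup.center P)).nontrivial_iff_card.mp inferInstance
    exact hcard ▸ dvd_pow_self p hn.ne'
  obtain ⟨x, hx⟩ := exists_prime_orderOf_dvd_card' p hcenter
  refine ⟨Subgroup.zpowers ((x : P) : G), ?_, fun hdiv => ?_⟩
  · rw [Nat.card_zpowers, Subgroup.orderOf_coe, Subgroup.orderOf_coe, hx]
  · refine P.not_dvd_index (hdiv.trans (Subgroup.index_dvd_of_le ?_))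
    rw [Subgroup.le_centralizer_iff, Subgroup.zpowers_le, Subgroup.mem_centralizer_iff]
    intro g hg
    exact congrArg Subtype.val (Subgroup.mem_center_iff.mp x.2 ⟨g, hg⟩)

theorem cdMeasure_bot (G : Type*) [Group G] : cdMeasure G ⊥ = Nat.card G := by
  have : Subgroup.centralizer ((⊥ : Subgroup G) : Set G) = ⊤ := by
    rw [Subgroup.centralizer_eq_top_iff_subset, Subgroup.coe_bot]
    simp
  rw [cdMeasure, this, Subgroup.card_bot, Subgroup.card_top, one_mul]

theorem cdMeasure_top (G : Type*) [Group G] :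
    cdMeasure G ⊤ = Nat.card G * Nat.card (Subgroup.center G) := by
  rw [cdMeasure, Subgroup.card_top, Subgroup.coe_top, Subgroup.centralizer_univ]

/-- If a finite group `G` satisfies `|CD(G)| = |L(G)| - 1`, then the unique subgroup
of `G` not belonging to `CD(G)` is the trivial subgroup: `CD(G) = L(G) \ {1}`. -/
theorem cd_eq_sub_one_missing_bot (G : Type*) [Group G] [Finite G]
    (h : Nat.card (cdLattice G) = Nat.card (Subgroup G) - 1) :
    cdLattice G = Set.univ \ {(⊥ : Subgroup G)} := by
  obtain ⟨H, hH⟩ := exists_eq_univ_sdiff_singleton h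
  suffices H = ⊥ by rw [hH, this]
  by_contra hne
  have hmem (K : Subgroup G) (hK : K ≠ H) : K ∈ cdLattice G := by simp [hH, hK]
  have hbot := hmem ⊥ (Ne.symm hne)
  have hmeasure (K : Subgroup G) (hK : K ≠ H) : cdMeasure G K = Nat.card G := by
    rw [← cdMeasure_bot G]
    exact le_antisymm (hbot K) (hmem K hK ⊥)
  have hcenter : Nat.card (Subgroup.center G) ≤ 1 := by
    have hle := hbot ⊤
    rw [cdMeasure_top, cdMeasure_bot] at hle
    exact Nat.le_of_mul_le_mul_left (hle.trans_eq (mul_one _).symm) Nat.card_pos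
  have hprime {p : ℕ} (hp : p.Prime) (hdvd : p ∣ Nat.card G) : p = Nat.card H := by
    obtain ⟨K, hK, hindex⟩ := exists_card_eq_prime_not_dvd_index_centralizer hp hdvd
    by_cases hKH : K = H
    · rw [← hKH, hK]
    have hcard := hmeasure K hKH
    rw [cdMeasure, hK, ← Subgroup.index_mul_card (Subgroup.centralizer (K : Set G))] at hcard
    exact absurd (Nat.eq_of_mul_eq_mul_right Nat.card_pos hcard).dvd hindex
  have hGne : Nat.card G ≠ 1 := fun hG => hne <| Subgroup.card_eq_one.mp <|
    Nat.dvd_one.mp (hG ▸ H.card_subgroup_dvd_card)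
  obtain ⟨p, hp, hdvd⟩ := Nat.exists_prime_and_dvd hGne
  have : Fact p.Prime := ⟨hp⟩
  have hG : IsPGroup p G := IsPGroup.of_card <|
    Nat.eq_prime_pow_of_unique_prime_dvd Nat.card_pos.ne' fun hq hqdvd =>
      (hprime hq hqdvd).trans (hprime hp hdvd).symm
  have : Nontrivial G := Finite.one_lt_card_iff_nontrivial.mp
    (by have := Nat.card_pos (α := G); omega)
  have := hG.center_nontrivial
  exact (Finite.one_lt_card (α := Subgroup.center G)).not_ge hcenter
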